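/- Let p and n be integers with p ≤ n ≤ 2p−5, set φ := n − p, and for 1 ≤ x ≤ n−1 let D_x := G_x⁻¹ · G_{n−1} in H_n. Then G_{n−1} · D_x · G_{n−1}⁻¹ lies in the subgroup U_{2φ+1} if x ≥ 2φ; in U_x if x < 2φ and x is odd; and in U_{x+1} if x < 2φ and x is even. -/

import Mathlib

/-- Right-angled Artin relations on `N` generators (indexed `0, …, N-1`, standing for
`h_1, …, h_N`): commutators of generators whose indices differ by more than one. -/
def RaagRels (N : ℕ) : Set (FreeGroup (Fin N)) :=
  {rel | ∃ i j : Fin N, (i : ℕ) + 1 < (j : ℕ) ∧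
    rel = FreeGroup.of i * FreeGroup.of j * (FreeGroup.of i)⁻¹ * (FreeGroup.of j)⁻¹}

/-- The right-angled Artin group `H_n` on generators `h_1, …, h_{n-1}` subject to
`h_i h_j = h_j h_i` whenever `|i - j| > 1`. -/
abbrev Hgrp (n : ℕ) := PresentedGroup (RaagRels (n - 1))

/-- The generator `h_i` of `H_n`, for `1 ≤ i ≤ n-1` (and `1` for out-of-range indices). -/
def hgen (n : ℕ) (i : ℕ) : Hgrp n :=
  if h : 1 ≤ i ∧ i ≤ n - 1 then PresentedGroup.of (⟨i - 1, by omega⟩ : Fin (n - 1)) else 1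

/-- `A(a,b) := h_a h_{a+1} ⋯ h_b` (the identity when `a > b`). -/
def Aprod (n a b : ℕ) : Hgrp n := ((List.range' a (b + 1 - a) 1).map (hgen n)).prod

/-- `E(a,b) := h_a h_{a+2} ⋯ h_b` for even `a, b` (the identity when `a > b`). -/
def Eprod (n a b : ℕ) : Hgrp n := ((List.range' a ((b + 2 - a) / 2) 2).map (hgen n)).prod

/-- `O(a,b) := h_a h_{a+2} ⋯ h_b` for odd `a, b` (the identity when `a > b`). -/
def Oprod (n a b : ℕ) : Hgrp n := ((List.range' a ((b + 2 - a) / 2) 2).map (hgen n)).prod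

/-- The elements `G_i` of `H_n` (with `φ := n - p`): `G_1 := h_1`,
`G_{2k} := O(3,2k-1)·E(2,2k)` and `G_{2k+1} := O(3,2k+1)·E(2,2k)` for `1 ≤ k ≤ φ`, and
`G_i := O(3,2φ+1)·E(2,2φ)·A(2φ+2,i)` for `2φ+2 ≤ i ≤ n-1`. -/
def Ggen (n p i : ℕ) : Hgrp n :=
  if i = 1 then hgen n 1
  else if i ≤ 2 * (n - p) + 1 then
    if i % 2 = 0 then Oprod n 3 (i - 1) * Eprod n 2 i
    else Oprod n 3 i * Eprod n 2 (i - 1)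
  else Oprod n 3 (2 * (n - p) + 1) * Eprod n 2 (2 * (n - p)) * Aprod n (2 * (n - p) + 2) i

/-- `L_m`: the subgroup of `H_n` generated by the `h_i` with `1 ≤ i ≤ min m (n-1)`. -/
def Lsub (n m : ℕ) : Subgroup (Hgrp n) :=
  Subgroup.closure {x | ∃ i : ℕ, 1 ≤ i ∧ i ≤ min m (n - 1) ∧ x = hgen n i}

/-- `U_m`: the subgroup of `H_n` generated by the `h_i` with `max m 1 ≤ i ≤ n-1`. -/
def Usub (n m : ℕ) : Subgroup (Hgrp n) :=
  Subgroup.closure {x | ∃ i : ℕ, max m 1 ≤ i ∧ i ≤ n - 1 ∧ x = hgen n i}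

theorem hgen_comm (n i j : ℕ) (h : i + 1 < j) : Commute (hgen n i) (hgen n j) := by
  unfold hgen
  split_ifs with h1 h2
  · have hr : (FreeGroup.of (⟨i - 1, by omega⟩ : Fin (n - 1)) *
        FreeGroup.of (⟨j - 1, by omega⟩ : Fin (n - 1)) *
        (FreeGroup.of (⟨i - 1, by omega⟩ : Fin (n - 1)))⁻¹ *
        (FreeGroup.of (⟨j - 1, by omega⟩ : Fin (n - 1)))⁻¹) ∈ RaagRels (n - 1) :=
      ⟨_, _, by simp only; omega, rfl⟩
    have := PresentedGroup.one_of_mem hr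
    simp only [map_mul, map_inv] at this
    have h3 := mul_inv_eq_one.mp this
    exact mul_inv_eq_iff_eq_mul.mp h3
  · exact Commute.one_right _
  · exact Commute.one_left _
  · exact Commute.one_left _

theorem hgen_mem (n m i : ℕ) (h : m ≤ i) : hgen n i ∈ Usub n m := by
  by_cases hi : 1 ≤ i ∧ i ≤ n - 1
  · exact Subgroup.subset_closure ⟨i, by omega, hi.2, rfl⟩
  · have : hgen n i = 1 := by unfold hgen; rw [dif_neg hi]
    rw [this]; exact one_mem _

theorem list_mem (n m : ℕ) (l : List ℕ) (h : ∀ y ∈ l, m ≤ y) :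
    (l.map (hgen n)).prod ∈ Usub n m := by
  apply Subgroup.list_prod_mem
  intro y hy
  obtain ⟨i, hi, rfl⟩ := List.mem_map.mp hy
  exact hgen_mem n m i (h i hi)

theorem list_comm (n m : ℕ) (l : List ℕ) (h : ∀ y ∈ l, y + 2 ≤ m) (g : Hgrp n)
    (hg : g ∈ Usub n m) : Commute (l.map (hgen n)).prod g := by
  have key : Usub n m ≤ Subgroup.centralizer {(l.map (hgen n)).prod} := by
    refine (Subgroup.closure_le _).mpr ?_
    rintro z ⟨i, hi, -, rfl⟩
    rw [SetLike.mem_coe, Subgroup.mem_centralizer_singleton_iff]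
    refine (Commute.list_prod_left _ _ ?_).symm.eq
    intro y hy
    obtain ⟨j, hj, rfl⟩ := List.mem_map.mp hy
    have := h j hj
    exact hgen_comm n j i (by omega)
  have := key hg
  rw [Subgroup.mem_centralizer_singleton_iff] at this
  exact (show Commute g _ from this).symm

theorem Usub_mono (n a b : ℕ) (h : a ≤ b) : Usub n b ≤ Usub n a := by
  refine (Subgroup.closure_le _).mpr ?_
  rintro z ⟨i, hi, -, rfl⟩
  exact hgen_mem n a i (by omega)

theorem Usub_one (n : ℕ) (g : Hgrp n) : g ∈ Usub n 1 := by
  have h : g ∈ Subgroup.closure (Set.range (PresentedGroup.of (rels := RaagRels (n - 1)))) := by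
    rw [PresentedGroup.closure_range_of]; trivial
  refine (Subgroup.closure_le _).mpr ?_ h
  rintro _ ⟨i, rfl⟩
  have := hgen_mem n 1 (i + 1) (by omega)
  unfold hgen at this
  rw [dif_pos ⟨by omega, by omega⟩] at this
  exact this

/-- Splitting of step-two products. -/
theorem split_two (n a m k : ℕ) :
    ((List.range' a (m + k) 2).map (hgen n)).prod =
      ((List.range' a m 2).map (hgen n)).prod *
        ((List.range' (a + 2 * m) k 2).map (hgen n)).prod := by
  rw [← List.prod_append, ← List.map_append, List.range'_append]

theorem O_split (n k f : ℕ) (hk : 1 ≤ k) (hf : k ≤ f) :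
    Oprod n 3 (2 * f + 1) = Oprod n 3 (2 * k - 1) * Oprod n (2 * k + 1) (2 * f + 1) := by
  unfold Oprod
  have := split_two n 3 (k - 1) (f + 1 - k)
  rw [show (2 * f + 1 + 2 - 3) / 2 = (k - 1) + (f + 1 - k) by omega, this,
    show (2 * k - 1 + 2 - 3) / 2 = k - 1 by omega,
    show (2 * f + 1 + 2 - (2 * k + 1)) / 2 = f + 1 - k by omega,
    show 3 + 2 * (k - 1) = 2 * k + 1 by omega]

theorem E_split (n k f : ℕ) (hk : 1 ≤ k) (hf : k ≤ f) :
    Eprod n 2 (2 * f) = Eprod n 2 (2 * k) * Eprod n (2 * k + 2) (2 * f) := by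
  unfold Eprod
  have := split_two n 2 k (f - k)
  rw [show (2 * f + 2 - 2) / 2 = k + (f - k) by omega, this,
    show (2 * k + 2 - 2) / 2 = k by omega,
    show (2 * f + 2 - (2 * k + 2)) / 2 = f - k by omega,
    show 2 + 2 * k = 2 * k + 2 by omega]

theorem O_mem (n a b : ℕ) : Oprod n a b ∈ Usub n a :=
  list_mem _ _ _ (by intro y hy; rw [List.mem_range'] at hy; obtain ⟨i, _, rfl⟩ := hy; omega)

theorem E_mem (n a b : ℕ) : Eprod n a b ∈ Usub n a := O_mem n a b

theorem A_mem (n a b : ℕ) : Aprod n a b ∈ Usub n a :=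
  list_mem _ _ _ (by intro y hy; rw [List.mem_range'] at hy; obtain ⟨i, _, rfl⟩ := hy; omega)

theorem O_comm (n a b : ℕ) (g : Hgrp n) (hg : g ∈ Usub n (b + 2)) : Commute (Oprod n a b) g :=
  list_comm n (b + 2) _
    (by intro y hy; rw [List.mem_range'] at hy; obtain ⟨i, hi, rfl⟩ := hy; omega) g hg

theorem E_comm (n a b : ℕ) (g : Hgrp n) (hg : g ∈ Usub n (b + 2)) : Commute (Eprod n a b) g :=
  O_comm n a b g hg

/-- Common shape of the elements `G_x`. -/
def Shape (n k : ℕ) (g : Hgrp n) : Prop :=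
  ∃ u ∈ Usub n (2 * k + 1), ∃ w ∈ Usub n (2 * k + 2),
    g = Oprod n 3 (2 * k - 1) * u * Eprod n 2 (2 * k) * w

theorem shape_big (n p k x : ℕ) (hk : 1 ≤ k) (hf : k ≤ n - p) (hx : 2 * (n - p) + 2 ≤ x) :
    Shape n k (Ggen n p x) := by
  refine ⟨Oprod n (2 * k + 1) (2 * (n - p) + 1), O_mem _ _ _,
    Eprod n (2 * k + 2) (2 * (n - p)) * Aprod n (2 * (n - p) + 2) x,
    mul_mem (E_mem _ _ _) (Usub_mono _ _ _ (by omega) (A_mem _ _ _)), ?_⟩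
  unfold Ggen
  rw [if_neg (by omega), if_neg (by omega), O_split n k _ hk hf, E_split n k _ hk hf]
  simp only [mul_assoc]

theorem shape_small (n p k x : ℕ) (hk : 1 ≤ k) (hf : k ≤ n - p)
    (hx : x = 2 * k ∨ x = 2 * k + 1) : Shape n k (Ggen n p x) := by
  rcases hx with rfl | rfl
  · refine ⟨1, one_mem _, 1, one_mem _, ?_⟩
    unfold Ggen
    rw [if_neg (by omega), if_pos (by omega), if_pos (by omega)]
    simp
  · refine ⟨Oprod n (2 * k + 1) (2 * k + 1), O_mem _ _ _, 1, one_mem _, ?_⟩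
    unfold Ggen
    rw [if_neg (by omega), if_pos (by omega), if_neg (by omega), O_split n k k hk le_rfl]
    simp

theorem shape_quot (n k : ℕ) (hk : 1 ≤ k) (g g' : Hgrp n) (h : Shape n k g)
    (h' : Shape n k g') : g * g'⁻¹ ∈ Usub n (2 * k + 1) := by
  obtain ⟨u, hu, w, hw, rfl⟩ := h
  obtain ⟨u', hu', w', hw', rfl⟩ := h'
  have hz : w * w'⁻¹ ∈ Usub n (2 * k + 2) := mul_mem hw (inv_mem hw')
  have c1 := (E_comm n 2 (2 * k) _ hz).eq
  have hv : u * (w * w'⁻¹) * u'⁻¹ ∈ Usub n (2 * k + 1) :=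
    mul_mem (mul_mem hu (Usub_mono _ _ _ (by omega) hz)) (inv_mem hu')
  have c2 := (O_comm n 3 (2 * k - 1) _
    (by rwa [show 2 * k - 1 + 2 = 2 * k + 1 by omega])).eq (b := u * (w * w'⁻¹) * u'⁻¹)
  generalize Oprod n 3 (2 * k - 1) = a at *
  generalize Eprod n 2 (2 * k) = e at *
  have : a * u * e * w * (a * u' * e * w')⁻¹ = u * (w * w'⁻¹) * u'⁻¹ := by
    calc _ = a * (u * (e * (w * w'⁻¹)) * e⁻¹ * u'⁻¹) * a⁻¹ := by group
      _ = a * (u * (w * w'⁻¹) * u'⁻¹) * a⁻¹ := by rw [c1]; group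
      _ = _ := by rw [c2]; group
  rw [this]; exact hv

/-- Lemma 6.7, item 3 (generic form):  for `p ≤ n ≤ 2p - 5`, `1 ≤ x ≤ n-1` and
`D_x := G_x⁻¹ G_{n-1}`, the conjugate `G_{n-1} D_x G_{n-1}⁻¹` lies in the subgroup
`U_{2φ+1}` if `x ≥ 2φ`; in `U_x` if `x < 2φ` and `x` is odd; and in `U_{x+1}` if
`x < 2φ` and `x` is even. -/
theorem stmt_18 (p n : ℕ) (hpn : p ≤ n) (hn : n ≤ 2 * p - 5)
    (x : ℕ) (hx1 : 1 ≤ x) (hx2 : x ≤ n - 1) :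
    (2 * (n - p) ≤ x →
      Ggen n p (n - 1) * ((Ggen n p x)⁻¹ * Ggen n p (n - 1)) * (Ggen n p (n - 1))⁻¹ ∈
        Usub n (2 * (n - p) + 1)) ∧
    (x < 2 * (n - p) → Odd x →
      Ggen n p (n - 1) * ((Ggen n p x)⁻¹ * Ggen n p (n - 1)) * (Ggen n p (n - 1))⁻¹ ∈
        Usub n x) ∧
    (x < 2 * (n - p) → Even x →
      Ggen n p (n - 1) * ((Ggen n p x)⁻¹ * Ggen n p (n - 1)) * (Ggen n p (n - 1))⁻¹ ∈
        Usub n (x + 1)) := by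
  have conj : Ggen n p (n - 1) * ((Ggen n p x)⁻¹ * Ggen n p (n - 1)) * (Ggen n p (n - 1))⁻¹ =
      Ggen n p (n - 1) * (Ggen n p x)⁻¹ := by group
  rw [conj]
  have key : ∀ k, 1 ≤ k → k ≤ n - p →
      (x = 2 * k ∨ x = 2 * k + 1 ∨ (k = n - p ∧ 2 * (n - p) + 2 ≤ x)) →
      Ggen n p (n - 1) * (Ggen n p x)⁻¹ ∈ Usub n (2 * k + 1) := by
    intro k hk hf h
    refine shape_quot n k hk _ _ (shape_big n p k _ hk hf (by omega)) ?_
    rcases h with h | h | ⟨-, h⟩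
    · exact shape_small n p k x hk hf (Or.inl h)
    · exact shape_small n p k x hk hf (Or.inr h)
    · exact shape_big n p k x hk hf h
  refine ⟨fun h => ?_, fun h ho => ?_, fun h he => ?_⟩
  · by_cases h0 : n - p = 0
    · rw [h0]; exact Usub_one _ _
    · exact key (n - p) (by omega) le_rfl (by omega)
  · obtain ⟨k, rfl⟩ := ho
    by_cases h0 : k = 0
    · subst h0; exact Usub_one _ _
    · exact key k (by omega) (by omega) (by omega)
  · obtain ⟨k, rfl⟩ := he
    rw [← two_mul]
    have := key k (by omega) (by omega) (by omega)
    rwa [← two_mul] at this
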